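/- Let π be a checking sequence such that π ⊆ π*₀ for some optimal checking sequence π*₀, and suppose test(e_b) < 0 for every block e_b addable to π whose password index is at most i_max. Then π is itself an optimal checking sequence. -/

import Mathlib

noncomputable section

/-- Parameters of the cost-asymmetric memory-hard password hashing model:
`n` passwords with probabilities `p 1 >= ... >= p n`, `m` breakpoints with
probabilities `q 1, ..., q m`, running-time breakpoints `t 0 < t 1 < ... < t m`,
memory-cost constant `cM` and password value `v`. -/
structure Params where
  n : ℕ
  m : ℕ
  p : ℕ → ℝ
  q : ℕ → ℝ
  t : ℕ → ℝ
  cM : ℝ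
  v : ℝ

namespace Params

/-- The standing hypotheses on the parameters. -/
structure Hyp (P : Params) : Prop where
  hn : 1 ≤ P.n
  hm : 1 ≤ P.m
  p_pos : ∀ i ∈ Finset.Icc 1 P.n, 0 < P.p i
  p_anti : ∀ i ∈ Finset.Icc 1 P.n, ∀ i' ∈ Finset.Icc 1 P.n, i ≤ i' → P.p i' ≤ P.p i
  p_sum : ∑ i ∈ Finset.Icc 1 P.n, P.p i ≤ 1
  q_nonneg : ∀ j ∈ Finset.Icc 1 P.m, 0 ≤ P.q j
  q_sum : ∑ j ∈ Finset.Icc 1 P.m, P.q j = 1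
  t_zero : P.t 0 = 0
  t_mono : ∀ j j', j < j' → j' ≤ P.m → P.t j < P.t j'
  cM_pos : 0 < P.cM
  v_pos : 0 < P.v

/-- Cumulative breakpoint probability `Q j = q 1 + ... + q j`. -/
def Q (P : Params) (j : ℕ) : ℝ := ∑ j' ∈ Finset.Icc 1 j, P.q j'

/-- Round cost `c(i, j) = cM * (t j ^ 2 - t (j-1) ^ 2)` of executing an
instruction with label index `j` (it does not depend on the password index). -/
def rc (P : Params) (j : ℕ) : ℝ := P.cM * (P.t j ^ 2 - P.t (j - 1) ^ 2)

/-- A checking sequence is determined by its exponent vector `τ`: for each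
password `i ∈ [1, n]` the attacker executes the instructions
`(i, 1), ..., (i, τ i)`, passwords being processed in increasing order.
`τ` is valid if `τ i ≤ m` for all `i` and `τ i = 0` outside `[1, n]`. -/
def Valid (P : Params) (τ : ℕ → ℕ) : Prop :=
  (∀ i, τ i ≤ P.m) ∧ ∀ i, i ∉ Finset.Icc 1 P.n → τ i = 0

/-- Success probability `λ(π)` of the checking sequence with exponent vector `τ`. -/
def lam (P : Params) (τ : ℕ → ℕ) : ℝ := ∑ i ∈ Finset.Icc 1 P.n, P.p i * P.Q (τ i)

/-- Probability mass `λ(π, k-1)` of the instructions strictly preceding the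
instruction `(i, j)` in the checking sequence with exponent vector `τ`. -/
def lamBefore (P : Params) (τ : ℕ → ℕ) (i j : ℕ) : ℝ :=
  (∑ i' ∈ Finset.Ico 1 i, P.p i' * P.Q (τ i')) + P.p i * P.Q (j - 1)

/-- Attacker's utility `U(π) = v·λ(π) - Σ_k c(π_k)·(1 - λ(π, k-1))`. -/
def U (P : Params) (τ : ℕ → ℕ) : ℝ :=
  P.v * P.lam τ -
    ∑ i ∈ Finset.Icc 1 P.n, ∑ j ∈ Finset.Icc 1 (τ i), P.rc j * (1 - P.lamBefore τ i j)

/-- A checking sequence is optimal if it maximizes the attacker's utility. -/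
def Optimal (P : Params) (τ : ℕ → ℕ) : Prop :=
  P.Valid τ ∧ ∀ τ', P.Valid τ' → P.U τ' ≤ P.U τ

/-- `π ⊆ π'` for checking sequences: `τ i ≤ τ' i` for all `i`. -/
def Subseq (P : Params) (τ τ' : ℕ → ℕ) : Prop := ∀ i, τ i ≤ τ' i

/-- `Π(l)`: the checking sequence fully checking the top `l` passwords
(`τ i = m` for `i ≤ l` and `τ i = 0` for `i > l`). -/
def Pifull (P : Params) (l : ℕ) : ℕ → ℕ := fun i => if 1 ≤ i ∧ i ≤ l then P.m else 0

/-- `F i`: the best marginal utility of appending a block `ϖ_i(1, j)`,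
`1 ≤ j ≤ m`, to `Π(i - 1)`. -/
def F (P : Params) (i : ℕ) : ℝ :=
  sSup ((fun j => P.U (Function.update (P.Pifull (i - 1)) i j) - P.U (P.Pifull (i - 1))) ''
    Set.Icc 1 P.m)

/-- `i_max`: the largest `i ∈ [1, n]` with `F i ≥ 0`, or `0` if there is none. -/
def imax (P : Params) : ℕ := sSup {i | i ∈ Finset.Icc 1 P.n ∧ 0 ≤ P.F i}

/-- Total round cost of the block `ϖ_i(1, j)`. -/
def blockCost (P : Params) (j : ℕ) : ℝ := ∑ j' ∈ Finset.Icc 1 j, P.rc j'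

/-- Utility of running the block `ϖ_i(1, j)` alone. -/
def blockUtil (P : Params) (i j : ℕ) : ℝ :=
  P.v * (P.p i * P.Q j) - ∑ j' ∈ Finset.Icc 1 j, P.rc j' * (1 - P.p i * P.Q (j' - 1))

/-- Probability mass of the instructions of `τ` with password index below `i`. -/
def massBelow (P : Params) (τ : ℕ → ℕ) (i : ℕ) : ℝ :=
  ∑ i' ∈ Finset.Ico 1 i, P.p i' * P.Q (τ i')

theorem U_eq_sum (P : Params) (τ : ℕ → ℕ) :
    P.U τ = ∑ i ∈ Finset.Icc 1 P.n,
      (P.blockUtil i (τ i) + P.massBelow τ i * P.blockCost (τ i)) := by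
  unfold U lam
  rw [Finset.mul_sum, ← Finset.sum_sub_distrib]
  refine Finset.sum_congr rfl fun i _ => ?_
  unfold blockUtil blockCost
  rw [Finset.mul_sum, sub_add, sub_right_inj, ← Finset.sum_sub_distrib]
  refine Finset.sum_congr rfl fun j _ => ?_
  unfold lamBefore massBelow
  ring

theorem massBelow_update_of_le (P : Params) (τ : ℕ → ℕ) {i k : ℕ} (j : ℕ) (h : k ≤ i) :
    P.massBelow (Function.update τ i j) k = P.massBelow τ k := by
  refine Finset.sum_congr rfl fun i' hi' => ?_
  rw [Function.update_of_ne (by have := Finset.mem_Ico.1 hi'; omega)]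

theorem massBelow_update_of_lt (P : Params) (τ : ℕ → ℕ) {i k : ℕ} (j : ℕ) (hi : 1 ≤ i)
    (h : i < k) :
    P.massBelow (Function.update τ i j) k =
      P.massBelow τ k + P.p i * (P.Q j - P.Q (τ i)) := by
  have hmem : i ∈ Finset.Ico 1 k := Finset.mem_Ico.2 ⟨hi, h⟩
  unfold massBelow
  rw [← Finset.add_sum_erase _ _ hmem,
    ← Finset.add_sum_erase _ (fun i' => P.p i' * P.Q (τ i')) hmem, Function.update_self,
    Finset.sum_congr rfl fun i' hi' => by
      rw [Function.update_of_ne (Finset.ne_of_mem_erase hi')]]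
  ring

theorem U_update_sub (P : Params) (τ : ℕ → ℕ) {i : ℕ} (j : ℕ) (hi : i ∈ Finset.Icc 1 P.n) :
    P.U (Function.update τ i j) - P.U τ =
      P.blockUtil i j - P.blockUtil i (τ i) +
        P.massBelow τ i * (P.blockCost j - P.blockCost (τ i)) +
        P.p i * (P.Q j - P.Q (τ i)) * ∑ k ∈ Finset.Icc 1 P.n with i < k, P.blockCost (τ k) := by
  have hi1 := (Finset.mem_Icc.1 hi).1
  rw [U_eq_sum, U_eq_sum, ← Finset.sum_sub_distrib, ← Finset.add_sum_erase _ _ hi,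
    Function.update_self, massBelow_update_of_le P τ j le_rfl]
  have key : ∑ k ∈ (Finset.Icc 1 P.n).erase i,
      ((P.blockUtil k (Function.update τ i j k) +
          P.massBelow (Function.update τ i j) k * P.blockCost (Function.update τ i j k)) -
        (P.blockUtil k (τ k) + P.massBelow τ k * P.blockCost (τ k))) =
      P.p i * (P.Q j - P.Q (τ i)) *
        ∑ k ∈ Finset.Icc 1 P.n with i < k, P.blockCost (τ k) := by
    have hfilter : (Finset.Icc 1 P.n).filter (i < ·) =
        ((Finset.Icc 1 P.n).erase i).filter (i < ·) := by
      ext k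
      simp only [Finset.mem_filter, Finset.mem_erase]
      constructor
      · rintro ⟨h, h'⟩
        exact ⟨⟨by omega, h⟩, h'⟩
      · rintro ⟨⟨_, h⟩, h'⟩
        exact ⟨h, h'⟩
    rw [hfilter, Finset.mul_sum, Finset.sum_filter]
    refine Finset.sum_congr rfl fun k hk => ?_
    have hki := Finset.ne_of_mem_erase hk
    rw [Function.update_of_ne hki]
    split_ifs with h
    · rw [massBelow_update_of_lt P τ j hi1 h]
      ring
    · rw [massBelow_update_of_le P τ j (not_lt.1 h)]
      ring
  rw [key]
  ring

theorem blockCost_sub (P : Params) {a b : ℕ} (h : a ≤ b) :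
    P.blockCost b - P.blockCost a = ∑ j ∈ Finset.Icc (a + 1) b, P.rc j := by
  induction b, h using Nat.le_induction with
  | base => simp
  | succ b hb ih =>
    rw [Finset.sum_Icc_succ_top (by omega), ← ih]
    unfold blockCost
    rw [Finset.sum_Icc_succ_top (by omega)]
    ring

theorem Q_sub (P : Params) {a b : ℕ} (h : a ≤ b) :
    P.Q b - P.Q a = ∑ j ∈ Finset.Icc (a + 1) b, P.q j := by
  induction b, h using Nat.le_induction with
  | base => simp
  | succ b hb ih =>
    rw [Finset.sum_Icc_succ_top (by omega), ← ih]
    unfold Q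
    rw [Finset.sum_Icc_succ_top (by omega)]
    ring

@[simp]
theorem blockCost_zero (P : Params) : P.blockCost 0 = 0 := by simp [blockCost]

@[simp]
theorem blockUtil_zero (P : Params) (i : ℕ) : P.blockUtil i 0 = 0 := by simp [blockUtil, Q]

theorem Hyp.Q_mono {P : Params} (hP : P.Hyp) {a b : ℕ} (h : a ≤ b) (hb : b ≤ P.m) :
    P.Q a ≤ P.Q b := by
  rw [← sub_nonneg, Q_sub P h]
  refine Finset.sum_nonneg fun j hj => hP.q_nonneg j ?_
  rw [Finset.mem_Icc] at hj ⊢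
  omega

theorem Hyp.rc_nonneg {P : Params} (hP : P.Hyp) {j : ℕ} (hj1 : 1 ≤ j) (hj : j ≤ P.m) :
    0 ≤ P.rc j := by
  have h1 : P.t (j - 1) < P.t j := hP.t_mono _ _ (by omega) hj
  have h0 : 0 ≤ P.t (j - 1) := by
    rcases Nat.eq_zero_or_pos (j - 1) with h | h
    · rw [h, hP.t_zero]
    · rw [← hP.t_zero]
      exact (hP.t_mono _ _ h (by omega)).le
  exact mul_nonneg hP.cM_pos.le (by nlinarith)

theorem Hyp.blockCost_mono {P : Params} (hP : P.Hyp) {a b : ℕ} (h : a ≤ b) (hb : b ≤ P.m) :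
    P.blockCost a ≤ P.blockCost b := by
  rw [← sub_nonneg, blockCost_sub P h]
  refine Finset.sum_nonneg fun j hj => ?_
  rw [Finset.mem_Icc] at hj
  exact hP.rc_nonneg (by omega) (by omega)

theorem Hyp.massBelow_mono {P : Params} (hP : P.Hyp) {σ τ : ℕ → ℕ} {i : ℕ} (hi : i ≤ P.n)
    (h : ∀ k ∈ Finset.Ico 1 i, σ k ≤ τ k) (hm : ∀ k ∈ Finset.Ico 1 i, τ k ≤ P.m) :
    P.massBelow σ i ≤ P.massBelow τ i := by
  refine Finset.sum_le_sum fun k hk => ?_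
  have hk' := Finset.mem_Ico.1 hk
  exact mul_le_mul_of_nonneg_left (hP.Q_mono (h k hk) (hm k hk))
    (hP.p_pos k (Finset.mem_Icc.2 ⟨hk'.1, by omega⟩)).le

theorem F_neg_of_imax_lt (P : Params) {i : ℕ} (hi : i ∈ Finset.Icc 1 P.n) (h : P.imax < i) :
    P.F i < 0 := by
  by_contra! hF
  exact h.not_ge (le_csSup ⟨P.n, fun k hk => (Finset.mem_Icc.1 hk.1).2⟩ ⟨hi, hF⟩)

theorem marginal_le_F (P : Params) (i : ℕ) {j : ℕ} (hj : j ∈ Set.Icc 1 P.m) :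
    P.U (Function.update (P.Pifull (i - 1)) i j) - P.U (P.Pifull (i - 1)) ≤ P.F i :=
  le_csSup ((Set.finite_Icc 1 P.m).image _).bddAbove ⟨j, hj, rfl⟩

/-- An optimal checking sequence contains no instruction with password index above `i_max`. -/
theorem Optimal.eq_zero_of_imax_lt {P : Params} (hP : P.Hyp) {τ : ℕ → ℕ} (hτ : P.Optimal τ)
    {i : ℕ} (hi : P.imax < i) : τ i = 0 := by
  obtain ⟨⟨hm, hout⟩, hopt⟩ := hτ
  induction hd : P.n - i using Nat.strong_induction_on generalizing i with
  | _ d ih =>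
    by_cases hmem : i ∈ Finset.Icc 1 P.n
    swap
    · exact hout i hmem
    obtain ⟨hi1, hin⟩ := Finset.mem_Icc.1 hmem
    have hlater : ∀ k ∈ (Finset.Icc 1 P.n).filter (i < ·), P.blockCost (τ k) = 0 := by
      intro k hk
      simp only [Finset.mem_filter, Finset.mem_Icc] at hk
      rw [ih (P.n - k) (by omega) (by omega) rfl, blockCost_zero]
    by_contra hne
    have hdrop := hopt (Function.update τ i 0) <| by
      constructor
      · intro k
        rcases eq_or_ne k i with rfl | hk
        · simp
        · rw [Function.update_of_ne hk]
          exact hm k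
      · intro k hk
        rw [Function.update_of_ne (by rintro rfl; exact hk hmem)]
        exact hout k hk
    rw [← sub_nonpos, U_update_sub P τ 0 hmem, Finset.sum_eq_zero hlater, blockCost_zero,
      blockUtil_zero] at hdrop
    have hF := (marginal_le_F P i ⟨Nat.one_le_iff_ne_zero.2 hne, hm i⟩).trans_lt
      (F_neg_of_imax_lt P hmem hi)
    have hfull : ∀ k, i ≤ k → P.Pifull (i - 1) k = 0 := fun k hk =>
      if_neg (by omega)
    rw [U_update_sub P _ _ hmem, hfull i le_rfl, blockCost_zero, blockUtil_zero,
      Finset.sum_eq_zero fun k hk => by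
        rw [hfull k (Finset.mem_filter.1 hk).2.le, blockCost_zero]] at hF
    have hmass : P.massBelow τ i ≤ P.massBelow (P.Pifull (i - 1)) i := by
      have hval : ∀ k ∈ Finset.Ico 1 i, P.Pifull (i - 1) k = P.m := fun k hk =>
        if_pos (by have := Finset.mem_Ico.1 hk; omega)
      exact hP.massBelow_mono hin (fun k hk => (hm k).trans (hval k hk).ge)
        fun k hk => (hval k hk).le
    have hcost : 0 ≤ P.blockCost (τ i) := by
      simpa using hP.blockCost_mono (Nat.zero_le _) (hm i)
    nlinarith [mul_le_mul_of_nonneg_right hmass hcost]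

/-- if `π ⊆ π*₀` for some optimal `π*₀` and `test(e_b) < 0` for
every block `e_b` addable to `π` with password index at most `i_max`, then `π`
is itself optimal. -/
theorem statement13 (P : Params) (hP : P.Hyp) (τ : ℕ → ℕ) (hτ : P.Valid τ)
    (τ0 : ℕ → ℕ) (hτ0 : P.Optimal τ0) (hsub : P.Subseq τ τ0)
    (htest : ∀ i, i ∈ Finset.Icc 1 P.n → i ≤ P.imax → ∀ j, τ i < j → j ≤ P.m →
      (P.U (Function.update τ i j) - P.U τ) +
          (∑ i' ∈ Finset.Ico 1 i, P.p i' * (P.Q P.m - P.Q (τ i'))) *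
            (∑ jj ∈ Finset.Icc (τ i + 1) j, P.rc jj) < 0) :
    P.Optimal τ := by
  have hm : ∀ i, τ0 i ≤ P.m := hτ0.1.1
  have hstep : ∀ k ≤ P.n, P.U (fun i => if i ≤ k then τ0 i else τ i) ≤ P.U τ := by
    intro k
    induction k with
    | zero =>
      intro _
      refine le_of_eq (congrArg P.U (funext fun i => ?_))
      split_ifs with h
      · rw [hτ.2 i (by simp; omega), hτ0.1.2 i (by simp; omega)]
      · rfl
    | succ k ih =>
      intro hk
      set σ : ℕ → ℕ := fun i => if i ≤ k then τ0 i else τ i with hσ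
      have hmem : k + 1 ∈ Finset.Icc 1 P.n := Finset.mem_Icc.2 ⟨by omega, hk⟩
      have hupd : (fun i => if i ≤ k + 1 then τ0 i else τ i) =
          Function.update σ (k + 1) (τ0 (k + 1)) := by
        funext i
        rcases eq_or_ne i (k + 1) with rfl | hi
        · simp
        · rw [Function.update_of_ne hi]
          have : i ≤ k + 1 ↔ i ≤ k := by omega
          simp only [this, hσ]
      rw [hupd]
      refine le_trans ?_ (ih (by omega))
      have hσabove : ∀ i, k < i → σ i = τ i := fun i hi => if_neg (by omega)
      rcases (hsub (k + 1)).eq_or_lt with heq | hlt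
      · rw [← heq, ← hσabove (k + 1) (by omega), Function.update_eq_self]
      have himax : k + 1 ≤ P.imax := by
        by_contra! h
        have := hτ0.eq_zero_of_imax_lt hP h
        omega
      have ht := htest (k + 1) hmem himax _ hlt (hm _)
      rw [U_update_sub P τ _ hmem, ← blockCost_sub P hlt.le] at ht
      rw [← sub_nonpos, U_update_sub P σ _ hmem, hσabove (k + 1) (by omega),
        Finset.sum_congr rfl fun i hi => by
          rw [hσabove i (by have := (Finset.mem_filter.1 hi).2; omega)]]
      have hmass : P.massBelow σ (k + 1) ≤ P.massBelow τ (k + 1) +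
          ∑ i ∈ Finset.Ico 1 (k + 1), P.p i * (P.Q P.m - P.Q (τ i)) := by
        refine (hP.massBelow_mono (τ := fun _ => P.m) hk (fun i _ => ?_)
          fun _ _ => le_rfl).trans_eq ?_
        · simp only [hσ]
          split_ifs
          exacts [hm i, hτ.1 i]
        · unfold massBelow
          rw [← Finset.sum_add_distrib]
          exact Finset.sum_congr rfl fun i _ => by ring
      have hcost := sub_nonneg.2 (hP.blockCost_mono hlt.le (hm (k + 1)))
      linarith [mul_le_mul_of_nonneg_right hmass hcost]
  refine ⟨hτ, fun τ' hτ' => (hτ0.2 τ' hτ').trans ?_⟩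
  have hend : (fun i => if i ≤ P.n then τ0 i else τ i) = τ0 := by
    funext i
    split_ifs with h
    · rfl
    · have hout : i ∉ Finset.Icc 1 P.n := fun hi => h (Finset.mem_Icc.1 hi).2
      rw [hτ.2 i hout, hτ0.1.2 i hout]
  exact hend ▸ hstep P.n le_rfl

end Params
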